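/- (Converse bound of Theorem 1, entropy form.) Consider the two-user erasure interference channel with delayed CSIT and spatially correlated links, with parameters 0 < p ≤ 1, q = 1-p, -1 ≤ ρ ≤ 1, blocklength n, and β = 2 - p - q*ρ. Then the conditional mutual informations satisfy I[W_1 : (Y_1[1],...,Y_1[n]) | (W_2, G[1],...,G[n])] + β · I[W_2 : (Y_2[1],...,Y_2[n]) | (G[1],...,G[n])] ≤ n · β · (1 - q^2) · log 2, and symmetrically with the roles of the two users exchanged. -/

import Mathlib

open Classical in
/-- Probability of an event on a finite probability space with weights `μ`. -/
noncomputable def pr {Ω : Type*} [Fintype Ω] (μ : Ω → ℝ) (E : Ω → Prop) : ℝ :=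
  ∑ ω, if E ω then μ ω else 0

/-- Conditional Shannon entropy `H[X | Y]` (natural logarithm):
`∑_y P(Y = y) · H[X | Y = y]`. -/
noncomputable def condEnt {Ω A B : Type*} [Fintype Ω] [Fintype A] [Fintype B]
    (μ : Ω → ℝ) (X : Ω → A) (Y : Ω → B) : ℝ :=
  ∑ b, ∑ a, pr μ (fun ω => Y ω = b) *
    Real.negMulLog (pr μ (fun ω => X ω = a ∧ Y ω = b) / pr μ (fun ω => Y ω = b))

/-- Conditional mutual information `I[X : Y | Z]` (natural logarithm). -/
noncomputable def condMI {Ω A B C : Type*} [Fintype Ω] [Fintype A] [Fintype B] [Fintype C]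
    (μ : Ω → ℝ) (X : Ω → A) (Y : Ω → B) (Z : Ω → C) : ℝ :=
  condEnt μ X Z + condEnt μ Y Z - condEnt μ (fun ω => (X ω, Y ω)) Z

/-- Two (finite-valued) random variables are independent. -/
def IndepRV {Ω A B : Type*} [Fintype Ω] (μ : Ω → ℝ) (X : Ω → A) (Y : Ω → B) : Prop :=
  ∀ a b, pr μ (fun ω => X ω = a ∧ Y ω = b) =
    pr μ (fun ω => X ω = a) * pr μ (fun ω => Y ω = b)

/-- The four components of a channel state `G[t] = (G₁₁[t], G₁₂[t], G₂₁[t], G₂₂[t])`. -/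
def g11 (s : ZMod 2 × ZMod 2 × ZMod 2 × ZMod 2) : ZMod 2 := s.1
def g12 (s : ZMod 2 × ZMod 2 × ZMod 2 × ZMod 2) : ZMod 2 := s.2.1
def g21 (s : ZMod 2 × ZMod 2 × ZMod 2 × ZMod 2) : ZMod 2 := s.2.2.1
def g22 (s : ZMod 2 × ZMod 2 × ZMod 2 × ZMod 2) : ZMod 2 := s.2.2.2


section helpers
open Classical

variable {Ω A B C D : Type*} [Fintype Ω]

theorem pr_congr (μ : Ω → ℝ) {E F : Ω → Prop} (h : ∀ ω, E ω ↔ F ω) : pr μ E = pr μ F := by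
  have : E = F := funext fun ω => propext (h ω)
  rw [this]

theorem pr_nonneg {μ : Ω → ℝ} (h0 : ∀ ω, 0 ≤ μ ω) (E : Ω → Prop) : 0 ≤ pr μ E :=
  Finset.sum_nonneg fun ω _ => by split_ifs <;> simp [h0]

theorem pr_mono {μ : Ω → ℝ} (h0 : ∀ ω, 0 ≤ μ ω) {E F : Ω → Prop} (h : ∀ ω, E ω → F ω) :
    pr μ E ≤ pr μ F := by
  refine Finset.sum_le_sum fun ω _ => ?_
  by_cases hE : E ω
  · simp [hE, h ω hE]
  · simp only [hE, if_false]; split_ifs <;> simp [h0]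

theorem le_pr {μ : Ω → ℝ} (h0 : ∀ ω, 0 ≤ μ ω) {E : Ω → Prop} (ω : Ω) (h : E ω) :
    μ ω ≤ pr μ E := by
  have := Finset.single_le_sum (f := fun ω => if E ω then μ ω else 0)
    (fun ω _ => by split_ifs <;> simp [h0]) (Finset.mem_univ ω)
  simpa [h, pr] using this

theorem pr_pos {μ : Ω → ℝ} (h0 : ∀ ω, 0 ≤ μ ω) {E : Ω → Prop} {ω : Ω} (hω : μ ω ≠ 0) (h : E ω) :
    0 < pr μ E := lt_of_lt_of_le (lt_of_le_of_ne (h0 ω) hω.symm) (le_pr h0 ω h)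

theorem pr_self_pos {μ : Ω → ℝ} (h0 : ∀ ω, 0 ≤ μ ω) {ω : Ω} (hω : μ ω ≠ 0) (X : Ω → A) :
    0 < pr μ (fun ω' => X ω' = X ω) := pr_pos h0 hω rfl

theorem pr_true (μ : Ω → ℝ) (h1 : ∑ ω, μ ω = 1) : pr μ (fun _ => True) = 1 := by
  simp [pr, h1]

theorem pr_split [Fintype A] (μ : Ω → ℝ) (E : Ω → Prop) (X : Ω → A) :
    pr μ E = ∑ a, pr μ (fun ω => E ω ∧ X ω = a) := by
  unfold pr
  rw [Finset.sum_comm]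
  refine Finset.sum_congr rfl fun ω _ => ?_
  by_cases hE : E ω <;> simp [hE]

/-- law of the unconscious statistician -/
theorem sum_pr [Fintype A] (μ : Ω → ℝ) (X : Ω → A) (h : A → ℝ) :
    ∑ ω, μ ω * h (X ω) = ∑ a, pr μ (fun ω => X ω = a) * h a := by
  unfold pr
  simp_rw [Finset.sum_mul]
  rw [Finset.sum_comm]
  refine Finset.sum_congr rfl fun ω _ => ?_
  simp

/-- Unconditional entropy. -/
noncomputable def Ent (μ : Ω → ℝ) (X : Ω → A) : ℝ :=
  ∑ ω, μ ω * (- Real.log (pr μ (fun ω' => X ω' = X ω)))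

theorem Ent_mono {μ : Ω → ℝ} (h0 : ∀ ω, 0 ≤ μ ω) {X : Ω → A} {Y : Ω → B}
    (h : ∀ ω ω', Y ω = Y ω' → X ω = X ω') : Ent μ X ≤ Ent μ Y := by
  refine Finset.sum_le_sum fun ω _ => ?_
  by_cases hω : μ ω = 0
  · simp [hω]
  refine mul_le_mul_of_nonneg_left (neg_le_neg ?_) (h0 ω)
  exact Real.log_le_log (pr_pos h0 hω rfl) (pr_mono h0 fun ω' => h ω' ω)

theorem Ent_eq {μ : Ω → ℝ} (h0 : ∀ ω, 0 ≤ μ ω) {X : Ω → A} {Y : Ω → B}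
    (h : ∀ ω ω', Y ω = Y ω' → X ω = X ω') (h' : ∀ ω ω', X ω = X ω' → Y ω = Y ω') :
    Ent μ X = Ent μ Y := le_antisymm (Ent_mono h0 h) (Ent_mono h0 h')

theorem condEnt_eq [Fintype A] [Fintype B] {μ : Ω → ℝ} (h0 : ∀ ω, 0 ≤ μ ω)
    (X : Ω → A) (Y : Ω → B) :
    condEnt μ X Y = Ent μ (fun ω => (X ω, Y ω)) - Ent μ Y := by
  unfold condEnt Ent
  rw [← Finset.sum_sub_distrib]
  let φ : A × B → ℝ := fun ab : A × B => (- Real.log (pr μ fun ω' => (X ω', Y ω') = ab) +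
        Real.log (pr μ fun ω' => Y ω' = ab.2))
  have : ∀ ω, μ ω * -Real.log (pr μ fun ω' => (X ω', Y ω') = (X ω, Y ω)) -
      μ ω * -Real.log (pr μ fun ω' => Y ω' = Y ω) = μ ω *
      φ (X ω, Y ω) := by
    intro ω; simp only [φ]; ring
  rw [Finset.sum_congr rfl fun ω _ => this ω, sum_pr μ (fun ω => (X ω, Y ω)), Fintype.sum_prod_type, Finset.sum_comm]
  refine Finset.sum_congr rfl fun a _ => Finset.sum_congr rfl fun b _ => ?_
  have e : pr μ (fun ω => (X ω, Y ω) = (a, b)) = pr μ (fun ω => X ω = a ∧ Y ω = b) :=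
    pr_congr μ fun ω => by simp
  simp only [φ, e]
  have hle : pr μ (fun ω => X ω = a ∧ Y ω = b) ≤ pr μ (fun ω => Y ω = b) :=
    pr_mono h0 fun ω h => h.2
  have hn := pr_nonneg h0 (fun ω => X ω = a ∧ Y ω = b)
  rcases hn.eq_or_lt with h | h
  · rw [← h]; simp
  · have hb : 0 < pr μ (fun ω => Y ω = b) := h.trans_le hle
    rw [Real.negMulLog, Real.log_div h.ne' hb.ne']
    field_simp
    ring

theorem gibbs [Fintype A] {μ : Ω → ℝ} (h0 : ∀ ω, 0 ≤ μ ω) (h1 : ∑ ω, μ ω = 1) (X : Ω → A)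
    (r : A → ℝ) (hr : ∀ a, 0 ≤ r a) (c : ℝ) (hc : 0 < c) (hrc : ∑ a, r a ≤ c)
    (hpos : ∀ ω, μ ω ≠ 0 → 0 < r (X ω)) :
    ∑ ω, μ ω * (Real.log (r (X ω)) - Real.log (pr μ fun ω' => X ω' = X ω)) ≤ Real.log c := by
  have key : ∀ ω, μ ω * (Real.log (r (X ω)) - Real.log (pr μ fun ω' => X ω' = X ω)) ≤
      μ ω * (fun a => r a / (pr μ fun ω' => X ω' = a) / c) (X ω) + μ ω * (Real.log c - 1) := by
    intro ω
    by_cases hω : μ ω = 0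
    · simp [hω]
    rw [← mul_add]
    refine mul_le_mul_of_nonneg_left ?_ (h0 ω)
    have hp := pr_pos h0 (E := fun ω' => X ω' = X ω) hω rfl
    have hr := hpos ω hω
    rw [← Real.log_div hr.ne' hp.ne']
    have := Real.log_le_sub_one_of_pos (show 0 < r (X ω) / (pr μ fun ω' => X ω' = X ω) / c by positivity)
    rw [Real.log_div (by positivity) hc.ne'] at this
    simp only []
    linarith
  refine (Finset.sum_le_sum fun ω _ => key ω).trans ?_
  rw [Finset.sum_add_distrib, ← Finset.sum_mul, h1, sum_pr μ X (fun a => r a / (pr μ fun ω' => X ω' = a) / c)]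
  have : ∑ a, pr μ (fun ω => X ω = a) * (r a / (pr μ fun ω' => X ω' = a) / c) ≤ ∑ a, r a / c := by
    refine Finset.sum_le_sum fun a _ => ?_
    rcases (pr_nonneg h0 (fun ω => X ω = a)).eq_or_lt with h | h
    · rw [← h]; simp; exact div_nonneg (hr a) hc.le
    · apply le_of_eq; field_simp
  rw [← Finset.sum_div] at this
  have h2 : (∑ a, r a) / c ≤ 1 := by rw [div_le_one hc]; exact hrc
  linarith

theorem Ent_bit [Fintype A] {μ : Ω → ℝ} (h0 : ∀ ω, 0 ≤ μ ω) (h1 : ∑ ω, μ ω = 1)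
    (Z : Ω → A) (X : Ω → ZMod 2) :
    Ent μ (fun ω => (Z ω, X ω)) - Ent μ Z ≤ Real.log 2 := by
  have hs : ∑ z, pr μ (fun ω => Z ω = z) = 1 := by
    have := sum_pr μ Z (fun _ => 1); simpa [h1] using this.symm
  have := gibbs h0 h1 (fun ω => (Z ω, X ω)) (fun zx => pr μ fun ω' => Z ω' = zx.1)
    (fun _ => pr_nonneg h0 _) 2 (by norm_num)
    (by rw [Fintype.sum_prod_type]; simp [← Finset.mul_sum, hs, ZMod.card])
    (fun ω hω => pr_pos h0 hω rfl)
  refine le_trans (le_of_eq ?_) this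
  unfold Ent
  rw [← Finset.sum_sub_distrib]
  exact Finset.sum_congr rfl fun ω _ => by simp only []; ring

theorem Ent_submod [Fintype A] [Fintype B] [Fintype C] {μ : Ω → ℝ}
    (h0 : ∀ ω, 0 ≤ μ ω) (h1 : ∑ ω, μ ω = 1)
    (X : Ω → A) (Y : Ω → B) (Z : Ω → C) :
    Ent μ (fun ω => (X ω, Y ω, Z ω)) + Ent μ Z ≤
      Ent μ (fun ω => (X ω, Z ω)) + Ent μ (fun ω => (Y ω, Z ω)) := by
  have hs : ∑ z, pr μ (fun ω => Z ω = z) = 1 := by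
    have := sum_pr μ Z (fun _ => 1); simpa [h1] using this.symm
  have hxz : ∀ z, ∑ x, pr μ (fun ω => (X ω, Z ω) = (x, z)) = pr μ (fun ω => Z ω = z) := by
    intro z
    rw [pr_split μ (fun ω => Z ω = z) X]
    exact Finset.sum_congr rfl fun x _ => pr_congr μ fun ω => by simp [and_comm]
  have hyz : ∀ z, ∑ y, pr μ (fun ω => (Y ω, Z ω) = (y, z)) = pr μ (fun ω => Z ω = z) := by
    intro z
    rw [pr_split μ (fun ω => Z ω = z) Y]
    exact Finset.sum_congr rfl fun x _ => pr_congr μ fun ω => by simp [and_comm]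
  have hsum : ∑ a : A × B × C, (pr μ fun ω' => (X ω', Z ω') = (a.1, a.2.2)) *
      (pr μ fun ω' => (Y ω', Z ω') = a.2) / (pr μ fun ω' => Z ω' = a.2.2) ≤ 1 := by
    rw [Fintype.sum_prod_type]
    simp_rw [Fintype.sum_prod_type]
    rw [Finset.sum_congr rfl fun x _ => Finset.sum_comm, Finset.sum_comm]
    simp_rw [← Finset.sum_div, ← Finset.mul_sum, hyz, ← Finset.sum_mul, hxz]
    rw [← hs]
    refine Finset.sum_le_sum fun z _ => le_of_eq ?_
    exact mul_self_div_self _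
  have := gibbs h0 h1 (fun ω => (X ω, Y ω, Z ω)) (fun a => (pr μ fun ω' => (X ω', Z ω') = (a.1, a.2.2)) *
      (pr μ fun ω' => (Y ω', Z ω') = a.2) / (pr μ fun ω' => Z ω' = a.2.2))
    (fun _ => div_nonneg (mul_nonneg (pr_nonneg h0 _) (pr_nonneg h0 _)) (pr_nonneg h0 _)) 1
    (by norm_num) hsum
    (fun ω hω => div_pos (mul_pos (pr_pos h0 hω rfl) (pr_pos h0 hω rfl)) (pr_pos h0 hω rfl))
  rw [Real.log_one] at this
  have e : ∑ ω, μ ω * (Real.log ((pr μ fun ω' => (X ω', Z ω') = (X ω, Z ω)) *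
      (pr μ fun ω' => (Y ω', Z ω') = (Y ω, Z ω)) / (pr μ fun ω' => Z ω' = Z ω)) -
      Real.log (pr μ fun ω' => (X ω', Y ω', Z ω') = (X ω, Y ω, Z ω))) =
      Ent μ (fun ω => (X ω, Y ω, Z ω)) + Ent μ Z -
      (Ent μ (fun ω => (X ω, Z ω)) + Ent μ (fun ω => (Y ω, Z ω))) := by
    unfold Ent
    rw [← Finset.sum_add_distrib, ← Finset.sum_add_distrib, ← Finset.sum_sub_distrib]
    refine Finset.sum_congr rfl fun ω _ => ?_
    by_cases hω : μ ω = 0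
    · simp [hω]
    have hx := pr_self_pos h0 hω (fun ω => (X ω, Z ω))
    have hy := pr_self_pos h0 hω (fun ω => (Y ω, Z ω))
    have hz := pr_self_pos h0 hω Z
    rw [Real.log_div (mul_pos hx hy).ne' hz.ne', Real.log_mul hx.ne' hy.ne']
    ring
  have this' := e ▸ this
  linarith

theorem Ent_indep [Fintype A] [Fintype B] {μ : Ω → ℝ}
    (h0 : ∀ ω, 0 ≤ μ ω) (V : Ω → A) (g : Ω → B)
    (hI : IndepRV μ V g) (F : B → Ω → C) (hF : ∀ γ ω ω', V ω = V ω' → F γ ω = F γ ω') :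
    Ent μ (fun ω => (F (g ω) ω, g ω)) =
      Ent μ g + ∑ γ, pr μ (fun ω => g ω = γ) * Ent μ (F γ) := by
  have hfac : ∀ γ (c : C), pr μ (fun ω => F γ ω = c ∧ g ω = γ) =
      pr μ (fun ω => F γ ω = c) * pr μ (fun ω => g ω = γ) := by
    intro γ c
    rw [pr_split μ _ V, pr_split μ (fun ω => F γ ω = c) V, Finset.sum_mul]
    refine Finset.sum_congr rfl fun v _ => ?_
    by_cases hv : ∃ ω, F γ ω = c ∧ V ω = v
    · obtain ⟨ω0, h1, h2⟩ := hv
      have hh : ∀ ω, V ω = v → F γ ω = c := fun ω h => (hF γ ω ω0 (h.trans h2.symm)).trans h1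
      rw [pr_congr μ (F := fun ω => V ω = v ∧ g ω = γ) (fun ω => ⟨fun h => ⟨h.2, h.1.2⟩,
        fun h => ⟨⟨hh ω h.1, h.2⟩, h.1⟩⟩), hI v γ,
        pr_congr μ (E := fun ω => F γ ω = c ∧ V ω = v) (F := fun ω => V ω = v) (fun ω => ⟨fun h => h.2, fun h => ⟨hh ω h, h⟩⟩)]
    · push Not at hv
      rw [pr_congr μ (F := fun _ => False) (fun ω => by have := hv ω; tauto),
        pr_congr μ (E := fun ω => F γ ω = c ∧ V ω = v) (F := fun _ => False)
          (fun ω => by have := hv ω; tauto)]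
      simp [pr]
  obtain ⟨φ, hφ⟩ : ∃ φ : A × B → ℝ, ∀ γ ω,
      φ (V ω, γ) = - Real.log (pr μ fun ω' => F γ ω' = F γ ω) := by
    refine ⟨fun x => if h : ∃ ω, V ω = x.1 then
      - Real.log (pr μ fun ω' => F x.2 ω' = F x.2 h.choose) else 0, fun γ ω => ?_⟩
    have h : ∃ ω', V ω' = V ω := ⟨ω, rfl⟩
    simp only [h, dif_pos]
    rw [hF γ _ ω h.choose_spec]
  have e2 : ∑ ω, μ ω * φ (V ω, g ω) = ∑ γ, pr μ (fun ω => g ω = γ) * Ent μ (F γ) := by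
    rw [sum_pr μ (fun ω => (V ω, g ω)) φ, Fintype.sum_prod_type, Finset.sum_comm]
    refine Finset.sum_congr rfl fun γ _ => ?_
    unfold Ent
    simp_rw [← hφ]
    rw [sum_pr μ V (fun v => φ (v, γ)), Finset.mul_sum]
    refine Finset.sum_congr rfl fun v _ => ?_
    rw [pr_congr μ (F := fun ω => V ω = v ∧ g ω = γ) (fun ω => by simp), hI v γ]
    ring
  rw [← e2]
  simp_rw [hφ]
  unfold Ent
  rw [← Finset.sum_add_distrib]
  refine Finset.sum_congr rfl fun ω _ => ?_
  by_cases hω : μ ω = 0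
  · simp [hω]
  have : (pr μ fun ω' => (F (g ω') ω', g ω') = (F (g ω) ω, g ω)) =
      pr μ (fun ω' => F (g ω) ω' = F (g ω) ω) * pr μ (fun ω' => g ω' = g ω) := by
    rw [← hfac]
    refine pr_congr μ fun ω' => ?_
    simp only [Prod.mk.injEq]
    constructor
    · rintro ⟨h, h'⟩; rw [h'] at h; exact ⟨h, h'⟩
    · rintro ⟨h, h'⟩; rw [h']; exact ⟨h, rfl⟩
  rw [this, Real.log_mul (pr_self_pos h0 hω (F (g ω))).ne' (pr_self_pos h0 hω g).ne']
  ring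

end helpers

section process
open Classical

variable {Ω 𝒲₁ 𝒲₂ S κ σ τ : Type*} [Fintype Ω]

/-- keep the entries before time `t`, replace the others by `0` -/
def mask {n : ℕ} [Zero σ] (t : ℕ) (g : Fin n → σ) : Fin n → σ :=
  fun i => if i.val < t then g i else 0

theorem mask_all {n : ℕ} [Zero σ] (g : Fin n → σ) : mask n g = g := by
  funext i; simp [mask, i.isLt]

theorem mask_eq_iff {n : ℕ} [Zero σ] (t : ℕ) (g h : Fin n → σ) :
    mask t g = mask t h ↔ ∀ i : Fin n, i.val < t → g i = h i := by
  constructor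
  · intro e i hi
    have := congrFun e i
    simpa [mask, hi] using this
  · intro e; funext i
    by_cases hi : i.val < t
    · simp [mask, hi, e i hi]
    · simp [mask, hi]

theorem mask_succ_iff {n : ℕ} [Zero σ] (t : Fin n) (g h : Fin n → σ) :
    mask (t.val + 1) g = mask (t.val + 1) h ↔ mask t.val g = mask t.val h ∧ g t = h t := by
  simp only [mask_eq_iff]
  constructor
  · intro e; exact ⟨fun i hi => e i (by omega), e t (by omega)⟩
  · rintro ⟨e, e'⟩ i hi
    rcases Nat.lt_succ_iff_lt_or_eq.mp hi with h | h
    · exact e i h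
    · rw [Fin.ext h]; exact e'

theorem indep_pre [Fintype S] [Zero S] [Fintype 𝒲₁] [Fintype 𝒲₂] {μ : Ω → ℝ}
    (h1 : ∑ ω, μ ω = 1) {n : ℕ}
    (W1 : Ω → 𝒲₁) (W2 : Ω → 𝒲₂) (G : Fin n → Ω → S)
    (hMut : ∀ (w1 : 𝒲₁) (w2 : 𝒲₂) (g : Fin n → S),
      pr μ (fun ω => W1 ω = w1 ∧ W2 ω = w2 ∧ (fun t => G t ω) = g) =
        pr μ (fun ω => W1 ω = w1) * pr μ (fun ω => W2 ω = w2) *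
          pr μ (fun ω => (fun t => G t ω) = g))
    (hTime : ∀ g : Fin n → S,
      pr μ (fun ω => (fun t => G t ω) = g) = ∏ t, pr μ (fun ω => G t ω = g t)) (t : Fin n) :
    IndepRV μ (fun ω => (W1 ω, W2 ω, mask t.val (fun i => G i ω))) (G t) := by
  rintro ⟨w1, w2, h⟩ γ
  have hm : ∑ s, pr μ (fun ω => G t ω = s) = 1 := by
    have := sum_pr μ (G t) (fun _ => 1); simpa [h1] using this.symm
  have gen : ∀ Q : S → Prop, pr μ (fun ω => W1 ω = w1 ∧ W2 ω = w2 ∧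
      mask t.val (fun i => G i ω) = h ∧ Q (G t ω)) =
      (∑ s, if Q s then pr μ (fun ω => G t ω = s) else 0) *
      (pr μ (fun ω => W1 ω = w1) * pr μ (fun ω => W2 ω = w2) *
      ∑ r : {j // j ≠ t} → S, if mask t.val ((Equiv.funSplitAt t S).symm (0, r)) = h then
        ∏ i : {j // j ≠ t}, pr μ (fun ω => G i.1 ω = r i) else 0) := by
    intro Q
    rw [pr_split μ _ (fun ω => (fun i => G i ω))]
    have e : ∀ g : Fin n → S, pr μ (fun ω => (W1 ω = w1 ∧ W2 ω = w2 ∧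
      mask t.val (fun i => G i ω) = h ∧ Q (G t ω)) ∧ (fun i => G i ω) = g) =
      if mask t.val g = h ∧ Q (g t) then pr μ (fun ω => W1 ω = w1) * pr μ (fun ω => W2 ω = w2) *
        ∏ i, pr μ (fun ω => G i ω = g i) else 0 := by
      intro g
      split_ifs with hc
      · rw [← hTime, ← hMut]
        refine pr_congr μ fun ω => ⟨fun h => ⟨h.1.1, h.1.2.1, h.2⟩, ?_⟩
        rintro ⟨a, b, rfl⟩
        exact ⟨⟨a, b, hc⟩, rfl⟩
      · rw [pr_congr μ (F := fun _ => False)]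
        · simp [pr]
        · intro ω
          simp only [iff_false]
          rintro ⟨⟨_, _, h'⟩, rfl⟩
          exact hc h'
    rw [Finset.sum_congr rfl fun g _ => e g, ← (Equiv.funSplitAt t S).symm.sum_comp,
      Fintype.sum_prod_type, Finset.sum_mul]
    refine Finset.sum_congr rfl fun s _ => ?_
    rw [Finset.mul_sum, Finset.mul_sum]
    refine Finset.sum_congr rfl fun r _ => ?_
    have hmask : mask t.val ((Equiv.funSplitAt t S).symm (s, r)) =
        mask t.val ((Equiv.funSplitAt t S).symm (0, r)) := by
      rw [mask_eq_iff]
      intro i hi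
      have : i ≠ t := fun h => by simp [h] at hi
      simp [this]
    have hat : (Equiv.funSplitAt t S).symm (s, r) t = s := by simp
    rw [hmask, hat, Fintype.prod_eq_mul_prod_subtype_ne _ t, hat]
    have hr : ∀ i : {j // j ≠ t}, (Equiv.funSplitAt t S).symm (s, r) i.1 = r i := by
      intro i; simp [i.2]
    simp_rw [hr]
    by_cases c1 : mask t.val ((Equiv.funSplitAt t S).symm (0, r)) = h
    · by_cases c2 : Q s
      · rw [if_pos ⟨c1, c2⟩, if_pos c1, if_pos c2]; ring
      · rw [if_neg (fun h => c2 h.2), if_neg c2]; ring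
    · rw [if_neg (fun h => c1 h.1), if_neg c1]; ring
  have g1 := gen (fun s => s = γ)
  have g2 := gen (fun _ => True)
  simp only [Finset.sum_ite_eq', Finset.mem_univ, if_true, hm, one_mul] at g1 g2
  rw [pr_congr μ (F := fun ω => W1 ω = w1 ∧ W2 ω = w2 ∧
      mask t.val (fun i => G i ω) = h ∧ G t ω = γ) (fun ω => by simp [and_assoc]), g1, ← g2,
      pr_congr μ (E := fun ω => (W1 ω, W2 ω, mask t.val (fun i => G i ω)) = (w1, w2, h))
      (F := fun ω => W1 ω = w1 ∧ W2 ω = w2 ∧ mask t.val (fun i => G i ω) = h ∧ True)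
      (fun ω => by simp)]
  ring

/-- entropy of the first `t` outputs given the side information and the first `t` states -/
noncomputable def DD {n : ℕ} [Zero S] [Zero σ] (μ : Ω → ℝ) (K : Ω → κ) (G : Fin n → Ω → S)
    (O : Fin n → Ω → σ) (t : ℕ) : ℝ :=
  Ent μ (fun ω => (K ω, mask t (fun i => G i ω), mask t (fun i => O i ω))) -
    Ent μ (fun ω => (K ω, mask t (fun i => G i ω)))

theorem DD_zero {n : ℕ} [Zero S] [Zero σ] {μ : Ω → ℝ} (h0 : ∀ ω, 0 ≤ μ ω)
    (K : Ω → κ) (G : Fin n → Ω → S) (O : Fin n → Ω → σ) : DD μ K G O 0 = 0 := by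
  unfold DD
  rw [sub_eq_zero]
  apply Ent_eq h0 <;> intro ω ω' h <;> simp only [mask_eq_iff, Prod.mk.injEq] at h ⊢ <;> simp_all

theorem DD_succ {τ : Type*} [Fintype S] [Fintype τ] {n : ℕ} [Zero S] [Zero σ] {μ : Ω → ℝ}
    (h0 : ∀ ω, 0 ≤ μ ω) (h1 : ∑ ω, μ ω = 1)
    (K : Ω → κ) (G : Fin n → Ω → S) (O : Fin n → Ω → σ) (t : Fin n) (V : Ω → τ)
    (hI : IndepRV μ V (G t))
    (hK : ∀ ω ω', V ω = V ω' → K ω = K ω')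
    (hG : ∀ ω ω', V ω = V ω' → mask t.val (fun i => G i ω) = mask t.val (fun i => G i ω'))
    (hO : ∀ ω ω', V ω = V ω' → mask t.val (fun i => O i ω) = mask t.val (fun i => O i ω'))
    (Φ : S → Ω → σ) (hΦ : ∀ γ ω ω', V ω = V ω' → Φ γ ω = Φ γ ω')
    (hOΦ : ∀ ω, O t ω = Φ (G t ω) ω) :
    DD μ K G O (t.val + 1) = DD μ K G O t.val + ∑ γ, pr μ (fun ω => G t ω = γ) *
      (Ent μ (fun ω => ((K ω, mask t.val (fun i => G i ω), mask t.val (fun i => O i ω)), Φ γ ω)) -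
        Ent μ (fun ω => (K ω, mask t.val (fun i => G i ω), mask t.val (fun i => O i ω)))) := by
  have hm : ∑ s, pr μ (fun ω => G t ω = s) = 1 := by
    have := sum_pr μ (G t) (fun _ => 1); simpa [h1] using this.symm
  have e1 := Ent_indep h0 V (G t) hI (fun γ ω =>
    ((K ω, mask t.val (fun i => G i ω), mask t.val (fun i => O i ω)), Φ γ ω))
    (fun γ ω ω' h => by simp only [hK ω ω' h, hG ω ω' h, hO ω ω' h, hΦ γ ω ω' h])
  have e2 := Ent_indep h0 V (G t) hI (fun _ ω => (K ω, mask t.val (fun i => G i ω)))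
    (fun γ ω ω' h => by simp only [hK ω ω' h, hG ω ω' h])
  rw [← Finset.sum_mul, hm, one_mul] at e2
  have e3 : Ent μ (fun ω => (K ω, mask (t.val + 1) (fun i => G i ω),
      mask (t.val + 1) (fun i => O i ω))) = Ent μ (fun ω => (((K ω, mask t.val (fun i => G i ω),
        mask t.val (fun i => O i ω)), Φ (G t ω) ω), G t ω)) := by
    simp_rw [← hOΦ]
    apply Ent_eq h0 <;> intro ω ω' h <;> simp only [Prod.mk.injEq, mask_succ_iff] at h ⊢ <;> tauto
  have e4 : Ent μ (fun ω => (K ω, mask (t.val + 1) (fun i => G i ω))) =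
      Ent μ (fun ω => ((K ω, mask t.val (fun i => G i ω)), G t ω)) := by
    apply Ent_eq h0 <;> intro ω ω' h <;> simp only [Prod.mk.injEq, mask_succ_iff] at h ⊢ <;> tauto
  unfold DD
  simp_rw [mul_sub]
  rw [Finset.sum_sub_distrib, ← Finset.sum_mul, hm, e3, e4, e1, e2]
  ring

end process

section half
open Classical

variable {Ω 𝒲₁ 𝒲₂ S : Type*} [Fintype Ω]

theorem sum_on [Fintype S] (μ : Ω → ℝ) (g : Ω → S) (on : S → Prop) (c : ℝ) :
    ∑ γ, pr μ (fun ω => g ω = γ) * (if on γ then c else 0) = pr μ (fun ω => on (g ω)) * c := by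
  rw [← sum_pr μ g (fun γ => if on γ then c else 0)]
  unfold pr
  rw [Finset.sum_mul]
  refine Finset.sum_congr rfl fun ω _ => ?_
  split_ifs <;> simp

theorem half [Fintype S] [Zero S] [Fintype 𝒲₁] [Fintype 𝒲₂] {μ : Ω → ℝ}
    (h0 : ∀ ω, 0 ≤ μ ω) (h1 : ∑ ω, μ ω = 1) {n : ℕ}
    (W1 : Ω → 𝒲₁) (W2 : Ω → 𝒲₂) (G : Fin n → Ω → S) (X1 X2 Y1 Y2 : Fin n → Ω → ZMod 2)
    (a11 a12 a21 a22 : S → ZMod 2) (β p r : ℝ) (hβ0 : 0 ≤ β)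
    (hI : ∀ t : Fin n, IndepRV μ (fun ω => (W1 ω, W2 ω, mask t.val (fun i => G i ω))) (G t))
    (hX1 : ∀ (t : Fin n) ω ω', W1 ω = W1 ω' →
      mask t.val (fun i => G i ω) = mask t.val (fun i => G i ω') → X1 t ω = X1 t ω')
    (hX2 : ∀ (t : Fin n) ω ω', W2 ω = W2 ω' →
      mask t.val (fun i => G i ω) = mask t.val (fun i => G i ω') → X2 t ω = X2 t ω')
    (hY1 : ∀ t ω, Y1 t ω = a11 (G t ω) * X1 t ω + a21 (G t ω) * X2 t ω)
    (hY2 : ∀ t ω, Y2 t ω = a12 (G t ω) * X1 t ω + a22 (G t ω) * X2 t ω)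
    (hon : ∀ t, pr μ (fun ω => a11 (G t ω) ≠ 0 ∨ a12 (G t ω) ≠ 0) = β * p)
    (h12 : ∀ t, pr μ (fun ω => a12 (G t ω) ≠ 0) = p)
    (hoff : ∀ t, pr μ (fun ω => a12 (G t ω) ≠ 0 ∨ a22 (G t ω) ≠ 0) = r) :
    condMI μ W1 (fun ω => fun t => Y1 t ω) (fun ω => (W2 ω, fun t => G t ω)) +
        β * condMI μ W2 (fun ω => fun t => Y2 t ω) (fun ω => fun t => G t ω) ≤
        n * β * r * Real.log 2 := by
  haveI : Fact (Nat.Prime 2) := ⟨Nat.prime_two⟩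
  -- everything before time `t` is determined by the messages and the first states
  have hX : ∀ (t : Fin n) ω ω', (W1 ω, W2 ω, mask t.val (fun i => G i ω)) =
      (W1 ω', W2 ω', mask t.val (fun i => G i ω')) → X1 t ω = X1 t ω' ∧ X2 t ω = X2 t ω' := by
    intro t ω ω' h
    simp only [Prod.mk.injEq] at h
    exact ⟨hX1 t ω ω' h.1 h.2.2, hX2 t ω ω' h.2.1 h.2.2⟩
  have hdet : ∀ (t : ℕ) ω ω', (W1 ω, W2 ω, mask t (fun i => G i ω)) =
      (W1 ω', W2 ω', mask t (fun i => G i ω')) → ∀ i : Fin n, i.val < t →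
      Y1 i ω = Y1 i ω' ∧ Y2 i ω = Y2 i ω' := by
    intro t ω ω' h i hi
    simp only [Prod.mk.injEq, mask_eq_iff] at h
    have hx := hX i ω ω' (by
      simp only [Prod.mk.injEq, mask_eq_iff]
      exact ⟨h.1, h.2.1, fun j hj => h.2.2 j (by omega)⟩)
    rw [hY1, hY1, hY2, hY2, hx.1, hx.2, h.2.2 i hi]
    exact ⟨rfl, rfl⟩
  -- pair of outputs
  let YY : Fin n → Ω → ZMod 2 × ZMod 2 := fun t ω => (Y1 t ω, Y2 t ω)
  let Z12 : ℕ → Ω → 𝒲₂ × (Fin n → S) × (Fin n → ZMod 2 × ZMod 2) := fun t ω =>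
    (W2 ω, mask t (fun i => G i ω), mask t (fun i => YY i ω))
  let Z2 : ℕ → Ω → 𝒲₂ × (Fin n → S) × (Fin n → ZMod 2) := fun t ω =>
    (W2 ω, mask t (fun i => G i ω), mask t (fun i => Y2 i ω))
  have s12 : ∀ t : Fin n, DD μ W2 G YY (t.val + 1) = DD μ W2 G YY t.val +
      β * p * (Ent μ (fun ω => (Z12 t.val ω, X1 t ω)) - Ent μ (Z12 t.val)) := by
    intro t
    rw [DD_succ h0 h1 W2 G YY t _ (hI t) (fun ω ω' h => by simp only [Prod.mk.injEq] at h; exact h.2.1)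
      (fun ω ω' h => by simp only [Prod.mk.injEq] at h; exact h.2.2)
      (fun ω ω' h => by
        rw [mask_eq_iff]; intro i hi
        have := hdet t.val ω ω' h i hi
        simp only [YY, this.1, this.2])
      (fun γ ω => (a11 γ * X1 t ω + a21 γ * X2 t ω, a12 γ * X1 t ω + a22 γ * X2 t ω))
      (fun γ ω ω' h => by simp only [hX t ω ω' h])
      (fun ω => by simp only [YY, hY1, hY2])]
    congr 1
    rw [← hon t, ← sum_on μ (G t) (fun γ => a11 γ ≠ 0 ∨ a12 γ ≠ 0)]
    refine Finset.sum_congr rfl fun γ _ => ?_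
    congr 1
    split_ifs with hc
    · congr 1
      apply Ent_eq h0 <;> intro ω ω' h <;> simp only [Z12, Prod.mk.injEq] at h ⊢
      · have := hX2 t ω ω' h.1.1 h.1.2.1
        rw [h.2, this]; exact ⟨h.1, rfl, rfl⟩
      · have := hX2 t ω ω' h.1.1 h.1.2.1
        refine ⟨h.1, ?_⟩
        rw [this] at h
        rcases hc with hc | hc
        · exact mul_left_cancel₀ hc (add_right_cancel h.2.1)
        · exact mul_left_cancel₀ hc (add_right_cancel h.2.2)
    · push Not at hc
      rw [sub_eq_zero]
      apply Ent_eq h0 <;> intro ω ω' h <;> simp only [Prod.mk.injEq] at h ⊢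
      · have := hX2 t ω ω' h.1 h.2.1
        rw [this, hc.1, hc.2]; simp [h]
      · exact h.1
  have s2 : ∀ t : Fin n, DD μ W2 G Y2 (t.val + 1) = DD μ W2 G Y2 t.val +
      p * (Ent μ (fun ω => (Z2 t.val ω, X1 t ω)) - Ent μ (Z2 t.val)) := by
    intro t
    rw [DD_succ h0 h1 W2 G Y2 t _ (hI t) (fun ω ω' h => by simp only [Prod.mk.injEq] at h; exact h.2.1)
      (fun ω ω' h => by simp only [Prod.mk.injEq] at h; exact h.2.2)
      (fun ω ω' h => by
        rw [mask_eq_iff]; intro i hi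
        exact (hdet t.val ω ω' h i hi).2)
      (fun γ ω => a12 γ * X1 t ω + a22 γ * X2 t ω)
      (fun γ ω ω' h => by simp only [hX t ω ω' h])
      (fun ω => by simp only [hY2])]
    congr 1
    rw [← h12 t, ← sum_on μ (G t) (fun γ => a12 γ ≠ 0)]
    refine Finset.sum_congr rfl fun γ _ => ?_
    congr 1
    split_ifs with hc
    · congr 1
      apply Ent_eq h0 <;> intro ω ω' h <;> simp only [Z2, Prod.mk.injEq] at h ⊢
      · have := hX2 t ω ω' h.1.1 h.1.2.1
        rw [h.2, this]; exact ⟨h.1, rfl⟩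
      · have := hX2 t ω ω' h.1.1 h.1.2.1
        refine ⟨h.1, ?_⟩
        rw [this] at h
        exact mul_left_cancel₀ hc (add_right_cancel h.2)
    · push Not at hc
      rw [sub_eq_zero]
      apply Ent_eq h0 <;> intro ω ω' h <;> simp only [Prod.mk.injEq] at h ⊢
      · have := hX2 t ω ω' h.1 h.2.1
        rw [this, hc]; simp [h]
      · exact h.1
  have s0 : ∀ t : Fin n, DD μ (fun _ => ()) G Y2 (t.val + 1) ≤ DD μ (fun _ => ()) G Y2 t.val +
      r * Real.log 2 := by
    intro t
    rw [DD_succ h0 h1 (fun _ => ()) G Y2 t _ (hI t) (fun ω ω' h => rfl)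
      (fun ω ω' h => by simp only [Prod.mk.injEq] at h; exact h.2.2)
      (fun ω ω' h => by
        rw [mask_eq_iff]; intro i hi
        exact (hdet t.val ω ω' h i hi).2)
      (fun γ ω => a12 γ * X1 t ω + a22 γ * X2 t ω)
      (fun γ ω ω' h => by simp only [hX t ω ω' h])
      (fun ω => by simp only [hY2])]
    gcongr
    rw [← hoff t, ← sum_on μ (G t) (fun γ => a12 γ ≠ 0 ∨ a22 γ ≠ 0)]
    refine Finset.sum_le_sum fun γ _ => mul_le_mul_of_nonneg_left ?_ (pr_nonneg h0 _)
    split_ifs with hc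
    · exact Ent_bit h0 h1 _ _
    · push Not at hc
      apply le_of_eq
      rw [sub_eq_zero]
      apply Ent_eq h0 <;> intro ω ω' h <;> simp only [Prod.mk.injEq] at h ⊢
      · rw [hc.1, hc.2]; simp [h]
      · exact h.1
  -- the induction
  have hp0 : ∀ _ : Fin n, 0 ≤ p := fun t => by rw [← h12 t]; exact pr_nonneg h0 _
  have ind : ∀ t : ℕ, t ≤ n → DD μ W2 G YY t ≤ β * DD μ W2 G Y2 t ∧
      DD μ (fun _ => ()) G Y2 t ≤ t * (r * Real.log 2) := by
    intro t
    induction t with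
    | zero => intro _; simp [DD_zero h0]
    | succ t ih =>
      intro ht
      obtain ⟨i1, i2⟩ := ih (by omega)
      have a := s12 ⟨t, ht⟩
      have b := s2 ⟨t, ht⟩
      have c := s0 ⟨t, ht⟩
      simp only [] at a b c
      have sub : Ent μ (fun ω => (Z12 t ω, X1 ⟨t, ht⟩ ω)) - Ent μ (Z12 t) ≤
          Ent μ (fun ω => (Z2 t ω, X1 ⟨t, ht⟩ ω)) - Ent μ (Z2 t) := by
        have := Ent_submod h0 h1 (X1 ⟨t, ht⟩) (Z12 t) (Z2 t)
        have hZ : ∀ ω ω', Z12 t ω = Z12 t ω' → Z2 t ω = Z2 t ω' := by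
          intro ω ω' h
          simp only [Z12, Z2, YY, Prod.mk.injEq, mask_eq_iff] at h ⊢
          exact ⟨h.1, h.2.1, fun i hi => (h.2.2 i hi).2⟩
        have e1 : Ent μ (fun ω => (X1 ⟨t, ht⟩ ω, Z12 t ω, Z2 t ω)) =
            Ent μ (fun ω => (Z12 t ω, X1 ⟨t, ht⟩ ω)) := by
          apply Ent_eq h0 <;> intro ω ω' h <;> rw [Prod.mk.injEq] at h
          · rw [h.1, h.2, hZ ω ω' h.1]
          · rw [Prod.mk.injEq] at h; rw [h.1, h.2.1]
        have e2 : Ent μ (fun ω => (Z12 t ω, Z2 t ω)) = Ent μ (Z12 t) := by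
          apply Ent_eq h0 <;> intro ω ω' h
          · rw [h, hZ ω ω' h]
          · rw [Prod.mk.injEq] at h; exact h.1
        have e3 : Ent μ (fun ω => (X1 ⟨t, ht⟩ ω, Z2 t ω)) =
            Ent μ (fun ω => (Z2 t ω, X1 ⟨t, ht⟩ ω)) := by
          apply Ent_eq h0 <;> intro ω ω' h <;> rw [Prod.mk.injEq] at h <;> rw [h.1, h.2]
        rw [e1, e2, e3] at this
        linarith
      have hm := mul_le_mul_of_nonneg_left sub (mul_nonneg hβ0 (hp0 ⟨t, ht⟩))
      constructor
      · rw [a, b]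
        nlinarith
      · push_cast
        linarith
  obtain ⟨i1, i2⟩ := ind n le_rfl
  -- the mutual informations
  have m1 : condMI μ W1 (fun ω => fun t => Y1 t ω) (fun ω => (W2 ω, fun t => G t ω)) ≤
      DD μ W2 G YY n := by
    unfold condMI DD
    rw [condEnt_eq h0, condEnt_eq h0, condEnt_eq h0]
    simp only [mask_all]
    have e : Ent μ (fun ω => ((W1 ω, fun t => Y1 t ω), W2 ω, fun t => G t ω)) =
        Ent μ (fun ω => (W1 ω, W2 ω, fun t => G t ω)) := by
      apply Ent_eq h0 <;> intro ω ω' h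
      · have h' := h
        simp only [Prod.mk.injEq] at h ⊢
        refine ⟨⟨h.1, ?_⟩, h.2⟩
        funext i
        exact (hdet n ω ω' (by simpa only [mask_all] using h') i i.isLt).1
      · simp only [Prod.mk.injEq] at h ⊢
        exact ⟨h.1.1, h.2⟩
    have e' : Ent μ (fun ω => ((fun t => Y1 t ω), W2 ω, fun t => G t ω)) ≤
        Ent μ (fun ω => (W2 ω, (fun t => G t ω), fun t => YY t ω)) := by
      apply Ent_mono h0
      intro ω ω' h
      simp only [Prod.mk.injEq] at h ⊢
      refine ⟨?_, h.1, h.2.1⟩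
      funext i
      exact congrArg Prod.fst (congrFun h.2.2 i)
    linarith
  have m2 : condMI μ W2 (fun ω => fun t => Y2 t ω) (fun ω => fun t => G t ω) =
      DD μ (fun _ => ()) G Y2 n - DD μ W2 G Y2 n := by
    unfold condMI DD
    rw [condEnt_eq h0, condEnt_eq h0, condEnt_eq h0]
    simp only [mask_all]
    have e1 : Ent μ (fun ω => ((W2 ω, fun t => Y2 t ω), fun t => G t ω)) =
        Ent μ (fun ω => (W2 ω, (fun t => G t ω), fun t => Y2 t ω)) := by
      apply Ent_eq h0 <;> intro ω ω' h <;> simp only [Prod.mk.injEq] at h ⊢ <;> tauto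
    have e2 : Ent μ (fun ω => ((fun t => Y2 t ω), fun t => G t ω)) =
        Ent μ (fun ω => ((), (fun t => G t ω), fun t => Y2 t ω)) := by
      apply Ent_eq h0 <;> intro ω ω' h <;> simp only [Prod.mk.injEq] at h ⊢ <;> tauto
    have e3 : Ent μ (fun ω => (fun t => G t ω)) =
        Ent μ (fun ω => ((), (fun t => G t ω))) := by
      apply Ent_eq h0 <;> intro ω ω' h <;> simp only [Prod.mk.injEq] at h ⊢ <;> tauto
    rw [e1, e2, e3]
    ring
  rw [m2]
  have := mul_le_mul_of_nonneg_left i2 hβ0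
  nlinarith

end half
/-- Converse bound of Theorem 1, entropy form: for the two-user erasure
interference channel with delayed CSIT and spatially correlated links, with `0 < p ≤ 1`,
`q = 1 - p`, `-1 ≤ ρ ≤ 1`, `β = 2 - p - qρ`,
`I[W₁ : Y₁ⁿ | (W₂, Gⁿ)] + β·I[W₂ : Y₂ⁿ | Gⁿ] ≤ n·β·(1 - q²)·log 2`,
and symmetrically with the two users exchanged. -/
theorem stmt_8 {Ω 𝒲₁ 𝒲₂ : Type*} [Fintype Ω] [Fintype 𝒲₁] [Fintype 𝒲₂]
    (μ : Ω → ℝ) (hμ0 : ∀ ω, 0 ≤ μ ω) (hμ1 : ∑ ω, μ ω = 1)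
    (p q ρ β : ℝ) (hp0 : 0 < p) (hp1 : p ≤ 1) (hq : q = 1 - p)
    (hρ1 : -1 ≤ ρ) (hρ2 : ρ ≤ 1) (hβ : β = 2 - p - q * ρ)
    (n : ℕ)
    (W1 : Ω → 𝒲₁) (W2 : Ω → 𝒲₂)
    (G : Fin n → Ω → ZMod 2 × ZMod 2 × ZMod 2 × ZMod 2)
    (X1 X2 Y1 Y2 : Fin n → Ω → ZMod 2)
    -- W₁, W₂ and the whole gain process are mutually independent
    (hMutIndep : ∀ (w1 : 𝒲₁) (w2 : 𝒲₂) (g : Fin n → ZMod 2 × ZMod 2 × ZMod 2 × ZMod 2),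
      pr μ (fun ω => W1 ω = w1 ∧ W2 ω = w2 ∧ (fun t => G t ω) = g) =
        pr μ (fun ω => W1 ω = w1) * pr μ (fun ω => W2 ω = w2) *
          pr μ (fun ω => (fun t => G t ω) = g))
    -- the states G[t] are independent across time …
    (hTimeIndep : ∀ g : Fin n → ZMod 2 × ZMod 2 × ZMod 2 × ZMod 2,
      pr μ (fun ω => (fun t => G t ω) = g) = ∏ t, pr μ (fun ω => G t ω = g t))
    -- … and identically distributed across time
    (hIdent : ∀ (t t' : Fin n) (s : ZMod 2 × ZMod 2 × ZMod 2 × ZMod 2),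
      pr μ (fun ω => G t ω = s) = pr μ (fun ω => G t' ω = s))
    -- the links of the two transmitters are independent at each time
    (hTxIndep : ∀ (t : Fin n) (a b c d : ZMod 2),
      pr μ (fun ω => g11 (G t ω) = a ∧ g12 (G t ω) = b ∧ g21 (G t ω) = c ∧ g22 (G t ω) = d) =
        pr μ (fun ω => g11 (G t ω) = a ∧ g12 (G t ω) = b) *
          pr μ (fun ω => g21 (G t ω) = c ∧ g22 (G t ω) = d))
    -- each link is Bernoulli(p)
    (hBern : ∀ t : Fin n,
      pr μ (fun ω => g11 (G t ω) = 1) = p ∧ pr μ (fun ω => g12 (G t ω) = 1) = p ∧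
      pr μ (fun ω => g21 (G t ω) = 1) = p ∧ pr μ (fun ω => g22 (G t ω) = 1) = p)
    -- the two links of each transmitter form a (p,ρ)-correlated Bernoulli pair
    (hCorr : ∀ t : Fin n,
      pr μ (fun ω => g11 (G t ω) = 1 ∧ g12 (G t ω) = 1) = p ^ 2 + p * q * ρ ∧
      pr μ (fun ω => g21 (G t ω) = 1 ∧ g22 (G t ω) = 1) = p ^ 2 + p * q * ρ)
    -- delayed CSIT: Xᵢ[t] is a deterministic function of Wᵢ and G[1..t-1]
    (hX1 : ∀ t : Fin n, ∃ f : 𝒲₁ → (Fin t.val → ZMod 2 × ZMod 2 × ZMod 2 × ZMod 2) → ZMod 2,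
      ∀ ω, X1 t ω = f (W1 ω) (fun s => G ⟨s.val, s.isLt.trans t.isLt⟩ ω))
    (hX2 : ∀ t : Fin n, ∃ f : 𝒲₂ → (Fin t.val → ZMod 2 × ZMod 2 × ZMod 2 × ZMod 2) → ZMod 2,
      ∀ ω, X2 t ω = f (W2 ω) (fun s => G ⟨s.val, s.isLt.trans t.isLt⟩ ω))
    -- channel outputs
    (hY1 : ∀ t ω, Y1 t ω = g11 (G t ω) * X1 t ω + g21 (G t ω) * X2 t ω)
    (hY2 : ∀ t ω, Y2 t ω = g12 (G t ω) * X1 t ω + g22 (G t ω) * X2 t ω) :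
    (condMI μ W1 (fun ω => fun t => Y1 t ω) (fun ω => (W2 ω, fun t => G t ω)) +
        β * condMI μ W2 (fun ω => fun t => Y2 t ω) (fun ω => fun t => G t ω) ≤
        n * β * (1 - q ^ 2) * Real.log 2) ∧
      (condMI μ W2 (fun ω => fun t => Y2 t ω) (fun ω => (W1 ω, fun t => G t ω)) +
        β * condMI μ W1 (fun ω => fun t => Y1 t ω) (fun ω => fun t => G t ω) ≤
        n * β * (1 - q ^ 2) * Real.log 2) := by

  have hz : ∀ x : ZMod 2, x ≠ 0 ↔ x = 1 := by decide
  have hz0 : ∀ x : ZMod 2, x = 0 ∨ x = 1 := by decide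
  have compl : ∀ E : Ω → Prop, pr μ E = 1 - pr μ (fun ω => ¬ E ω) := by
    intro E
    rw [← pr_true μ hμ1]
    unfold pr
    rw [← Finset.sum_sub_distrib]
    refine Finset.sum_congr rfl fun ω _ => ?_
    by_cases h : E ω <;> simp [h]
  have two : ∀ (E : Ω → Prop) (x : Ω → ZMod 2),
      pr μ E = pr μ (fun ω => E ω ∧ x ω = 0) + pr μ (fun ω => E ω ∧ x ω = 1) := by
    intro E x
    rw [pr_split μ E x]
    exact Fin.sum_univ_two (fun a : Fin 2 => pr μ (fun ω => E ω ∧ x ω = a))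
  have incl : ∀ E F : Ω → Prop, pr μ (fun ω => E ω ∨ F ω) =
      pr μ E + pr μ F - pr μ (fun ω => E ω ∧ F ω) := by
    intro E F
    unfold pr
    rw [← Finset.sum_add_distrib, ← Finset.sum_sub_distrib]
    refine Finset.sum_congr rfl fun ω _ => ?_
    by_cases h : E ω <;> by_cases h' : F ω <;> simp [h, h']
  have zer : ∀ x : Ω → ZMod 2, pr μ (fun ω => x ω = 1) = p → pr μ (fun ω => x ω = 0) = q := by
    intro x hx
    rw [compl, hq, ← hx]
    congr 1
    exact pr_congr μ fun ω => hz (x ω)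
  have hβ0 : 0 ≤ β := by nlinarith
  have d1 : ∀ (t : Fin n) ω ω', W1 ω = W1 ω' →
      mask t.val (fun i => G i ω) = mask t.val (fun i => G i ω') → X1 t ω = X1 t ω' := by
    intro t ω ω' hw hg
    obtain ⟨f, hf⟩ := hX1 t
    rw [hf, hf, hw]
    congr 1
    funext s
    exact (mask_eq_iff _ _ _).1 hg ⟨s.val, s.isLt.trans t.isLt⟩ s.isLt
  have d2 : ∀ (t : Fin n) ω ω', W2 ω = W2 ω' →
      mask t.val (fun i => G i ω) = mask t.val (fun i => G i ω') → X2 t ω = X2 t ω' := by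
    intro t ω ω' hw hg
    obtain ⟨f, hf⟩ := hX2 t
    rw [hf, hf, hw]
    congr 1
    funext s
    exact (mask_eq_iff _ _ _).1 hg ⟨s.val, s.isLt.trans t.isLt⟩ s.isLt
  have I1 := indep_pre hμ1 W1 W2 G hMutIndep hTimeIndep
  have I2 := indep_pre hμ1 W2 W1 G (fun w2 w1 g => by
    rw [mul_comm (pr μ fun ω => W2 ω = w2), ← hMutIndep]
    exact pr_congr μ fun ω => by tauto) hTimeIndep
  -- marginals of the pair of links seen by a receiver
  have r2 : ∀ t, pr μ (fun ω => g12 (G t ω) = 0 ∧ g22 (G t ω) = 0) = q ^ 2 := by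
    intro t
    have z1 := zer _ (hBern t).2.1
    have z2 := zer _ (hBern t).2.2.2
    rw [two _ (fun ω => g11 (G t ω))] at z1
    rw [two _ (fun ω => g21 (G t ω))] at z2
    have e : ∀ a c, pr μ (fun ω => ((g12 (G t ω) = 0 ∧ g22 (G t ω) = 0) ∧ g11 (G t ω) = a) ∧
        g21 (G t ω) = c) = pr μ (fun ω => g12 (G t ω) = 0 ∧ g11 (G t ω) = a) *
        pr μ (fun ω => g22 (G t ω) = 0 ∧ g21 (G t ω) = c) := by
      intro a c
      rw [pr_congr μ (F := fun ω => g11 (G t ω) = a ∧ g12 (G t ω) = 0 ∧ g21 (G t ω) = c ∧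
        g22 (G t ω) = 0) (fun ω => by tauto), hTxIndep]
      congr 1 <;> exact pr_congr μ fun ω => and_comm
    rw [two _ (fun ω => g11 (G t ω)), two (fun ω => _ ∧ g11 (G t ω) = 0) (fun ω => g21 (G t ω)),
      two (fun ω => _ ∧ g11 (G t ω) = 1) (fun ω => g21 (G t ω)), e, e, e, e, sq]
    nth_rewrite 1 [← z1]
    rw [← z2]
    ring
  have r1 : ∀ t, pr μ (fun ω => g21 (G t ω) = 0 ∧ g11 (G t ω) = 0) = q ^ 2 := by
    intro t
    have z1 := zer _ (hBern t).1
    have z2 := zer _ (hBern t).2.2.1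
    rw [two _ (fun ω => g12 (G t ω))] at z1
    rw [two _ (fun ω => g22 (G t ω))] at z2
    have e : ∀ a c, pr μ (fun ω => ((g21 (G t ω) = 0 ∧ g11 (G t ω) = 0) ∧ g12 (G t ω) = a) ∧
        g22 (G t ω) = c) = pr μ (fun ω => g11 (G t ω) = 0 ∧ g12 (G t ω) = a) *
        pr μ (fun ω => g21 (G t ω) = 0 ∧ g22 (G t ω) = c) := by
      intro a c
      rw [pr_congr μ (F := fun ω => g11 (G t ω) = 0 ∧ g12 (G t ω) = a ∧ g21 (G t ω) = 0 ∧
        g22 (G t ω) = c) (fun ω => by tauto), hTxIndep]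
    rw [two _ (fun ω => g12 (G t ω)), two (fun ω => _ ∧ g12 (G t ω) = 0) (fun ω => g22 (G t ω)),
      two (fun ω => _ ∧ g12 (G t ω) = 1) (fun ω => g22 (G t ω)), e, e, e, e, sq]
    nth_rewrite 1 [← z1]
    rw [← z2]
    ring
  constructor
  · refine half hμ0 hμ1 W1 W2 G X1 X2 Y1 Y2 g11 g12 g21 g22 β p (1 - q ^ 2) hβ0 I1 d1 d2 hY1 hY2
      (fun t => ?_) (fun t => ?_) (fun t => ?_)
    · simp only [hz]
      rw [incl, (hBern t).1, (hBern t).2.1, (hCorr t).1, hβ, hq]; ring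
    · simp only [hz]; exact (hBern t).2.1
    · rw [compl, ← r2 t]
      congr 1
      exact pr_congr μ fun ω => by tauto
  · refine half hμ0 hμ1 W2 W1 G X2 X1 Y2 Y1 g22 g21 g12 g11 β p (1 - q ^ 2) hβ0 I2 d2 d1
      (fun t ω => by rw [hY2]; ring) (fun t ω => by rw [hY1]; ring)
      (fun t => ?_) (fun t => ?_) (fun t => ?_)
    · simp only [hz]
      rw [incl, pr_congr μ (E := fun ω => g22 (G t ω) = 1 ∧ g21 (G t ω) = 1) (fun ω => and_comm),
        (hBern t).2.2.1, (hBern t).2.2.2, (hCorr t).2, hβ, hq]; ring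
    · simp only [hz]; exact (hBern t).2.2.1
    · rw [compl, ← r1 t]
      congr 1
      exact pr_congr μ fun ω => by tauto
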